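/- Suppose f is (α,β)-regular with α > β ≥ 0 and x* ∈ X solves the variational inequality ⟨∇f_{x*}(x*), x − x*⟩ ≥ 0 for all x ∈ X. Then for any sequence (x_n) in X and all N: Regret^d_N ≤ Regret^s_N(x*) + (β²/(2α(α−β)))·∑_{n=1}^N ⟨∇f_{x_n}(x_n), x_n − x*⟩, where the last sum is the static regret against x* of the linearized losses x ↦ ⟨∇f_{x_n}(x_n), x⟩. -/

import Mathlib

open RealInnerProductSpace

open Topology in
/-- First-order lower bound for a differentiable strongly convex function. -/
theorem StrongConvexOn.add_inner_gradient_le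
    {E : Type*} [NormedAddCommGroup E] [InnerProductSpace ℝ E] [CompleteSpace E]
    {s : Set E} {m : ℝ} {g : E → ℝ} {g' a b : E} (hg : StrongConvexOn s m g)
    (ha : a ∈ s) (hb : b ∈ s) (hd : HasGradientAt g g' a) :
    g a + ⟪g', b - a⟫ + m / 2 * ‖b - a‖ ^ 2 ≤ g b := by
  have hline : HasDerivAt (fun t : ℝ => a + t • (b - a)) (b - a) 0 := by
    simpa using ((hasDerivAt_id (0 : ℝ)).smul_const (b - a)).const_add a
  have hderiv : HasDerivAt (fun t : ℝ => g (a + t • (b - a))) ⟪g', b - a⟫ 0 := by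
    have hfd : HasFDerivAt g (InnerProductSpace.toDual ℝ E g') (a + (0 : ℝ) • (b - a)) := by
      simpa using hd.hasFDerivAt
    have hcomp := hfd.comp_hasDerivAt (0 : ℝ) hline
    rw [InnerProductSpace.toDual_apply_apply] at hcomp
    exact hcomp
  have hlim := hderiv.tendsto_slope_zero_right
  have hlim' : Filter.Tendsto (fun t : ℝ => g b - g a - (1 - t) * (m / 2 * ‖b - a‖ ^ 2))
      (𝓝[>] 0) (𝓝 (g b - g a - (1 - 0) * (m / 2 * ‖b - a‖ ^ 2))) :=
    (Continuous.tendsto (by fun_prop) 0).mono_left nhdsWithin_le_nhds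
  have hle := le_of_tendsto_of_tendsto hlim hlim' (by
    filter_upwards [Ioo_mem_nhdsGT (zero_lt_one' ℝ)] with t ht
    have hconv := hg.2 ha hb (sub_nonneg.2 ht.2.le) ht.1.le (sub_add_cancel 1 t)
    have hpt : (1 - t) • a + t • b = a + t • (b - a) := by module
    rw [hpt, norm_sub_rev a b] at hconv
    simp only [smul_eq_mul, zero_add, zero_smul, add_zero] at hconv ⊢
    rw [inv_mul_le_iff₀ ht.1]
    linarith)
  linarith

/-- If `f` is `(α,β)`-regular with `α > β ≥ 0` and `x*` solves the variational inequality,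
then `Regret^d_N ≤ Regret^s_N(x*) + (β²/(2α(α−β)))·∑ ⟪∇f_{x_n}(x_n), x_n − x*⟫`, where the
last sum is the static regret of the linearized losses against `x*`. -/
theorem stmt_12
    {E : Type*} [NormedAddCommGroup E] [InnerProductSpace ℝ E] [FiniteDimensional ℝ E]
    (X : Set E) (hXne : X.Nonempty) (hXcp : IsCompact X) (hXcv : Convex ℝ X)
    (f : E → E → ℝ) (f' : E → E → E) (α β : ℝ) (hβ : 0 ≤ β) (hαβ : β < α)
    (hgrad : ∀ x ∈ X, ∀ x' ∈ X, HasGradientAt (f x) (f' x x') x')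
    (hsc : ∀ x ∈ X, StrongConvexOn X α (f x))
    (hlip : ∀ x' ∈ X, ∀ x ∈ X, ∀ y ∈ X, ‖f' x x' - f' y x'‖ ≤ β * ‖x - y‖)
    (xs : E) (hxs : xs ∈ X)
    (hVI : ∀ x ∈ X, ⟪f' xs xs, x - xs⟫ ≥ 0)
    (x : ℕ → E) (hx : ∀ n, x n ∈ X) :
    ∀ N : ℕ,
      ∑ n ∈ Finset.Icc 1 N, (f (x n) (x n) - sInf (f (x n) '' X)) ≤
        (∑ n ∈ Finset.Icc 1 N, (f (x n) (x n) - f (x n) xs)) +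
        β ^ 2 / (2 * α * (α - β)) *
          ∑ n ∈ Finset.Icc 1 N, ⟪f' (x n) (x n), x n - xs⟫ := by
  intro N
  rw [Finset.mul_sum, ← Finset.sum_add_distrib]
  refine Finset.sum_le_sum fun n _ => ?_
  have hα : 0 < α := hβ.trans_lt hαβ
  have hgap : 0 < α - β := sub_pos.2 hαβ
  have hpert : ∀ y ∈ X, -(β * ‖x n - xs‖ * ‖y - xs‖) ≤ ⟪f' (x n) xs, y - xs⟫ := fun y hy => by
    have hcs := neg_le_of_abs_le (abs_real_inner_le_norm (f' (x n) xs - f' xs xs) (y - xs))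
    have hmul := mul_le_mul_of_nonneg_right (hlip xs hxs (x n) (hx n) xs hxs)
      (norm_nonneg (y - xs))
    rw [inner_sub_left] at hcs
    linarith [hVI y hy]
  have hmono : (α - β) * ‖x n - xs‖ ^ 2 ≤ ⟪f' (x n) (x n), x n - xs⟫ := by
    have h₁ := (hsc _ (hx n)).add_inner_gradient_le (hx n) hxs (hgrad _ (hx n) _ (hx n))
    have h₂ := (hsc _ (hx n)).add_inner_gradient_le hxs (hx n) (hgrad _ (hx n) _ hxs)
    rw [← neg_sub (x n) xs, inner_neg_right, norm_neg] at h₁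
    linarith [hpert _ (hx n)]
  have hquad : β ^ 2 / (2 * α) * ‖x n - xs‖ ^ 2 ≤
      β ^ 2 / (2 * α * (α - β)) * ⟪f' (x n) (x n), x n - xs⟫ :=
    calc β ^ 2 / (2 * α) * ‖x n - xs‖ ^ 2
        = β ^ 2 / (2 * α * (α - β)) * ((α - β) * ‖x n - xs‖ ^ 2) := by field_simp
      _ ≤ _ := mul_le_mul_of_nonneg_left hmono (by positivity)
  have hinf : f (x n) xs - β ^ 2 / (2 * α) * ‖x n - xs‖ ^ 2 ≤ sInf (f (x n) '' X) := by
    refine le_csInf (hXne.image _) ?_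
    rintro _ ⟨y, hy, rfl⟩
    have hfo := (hsc _ (hx n)).add_inner_gradient_le hxs hy (hgrad _ (hx n) _ hxs)
    have hsq : β ^ 2 / (2 * α) * ‖x n - xs‖ ^ 2 - β * ‖x n - xs‖ * ‖y - xs‖
        + α / 2 * ‖y - xs‖ ^ 2 = (β * ‖x n - xs‖ - α * ‖y - xs‖) ^ 2 / (2 * α) := by
      field_simp
      ring
    have hnn : 0 ≤ (β * ‖x n - xs‖ - α * ‖y - xs‖) ^ 2 / (2 * α) := by positivity
    linarith [hpert y hy]
  linarith
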